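/- Let V_d0, I_d0, I_q0 be real numbers with V_d0 ≠ 0, and let Y ∈ ℂ^{2×2}. Define the column vectors u = (0, V_d0)ᵀ and w = (−I_q0, I_d0)ᵀ, the row vectors V₀ = (V_d0, 0) and I₀ = (I_d0, I_q0), and the row vector g = V₀Y + I₀ ∈ ℂ². Assume g·u ≠ 0 (equivalently, V_d0·Y₀₁ + I_q0 ≠ 0). Then the matrix M := Y − (g·u)⁻¹ · (Yu − w) gᵀ (where (Yu − w) gᵀ is the outer product of the column vector Yu − w with the row vector g) satisfies M₀₀ = −I_d0/V_d0, M₀₁ = −I_q0/V_d0, M₁₁ = I_d0/V_d0, and in particular tr M = 0. -/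

import Mathlib

open scoped Matrix

/-- DC-gain closed-loop admittance of a GFM converter with power-based
synchronization: the entries of `M = Y − (g·u)⁻¹ (Y u − w) gᵀ` at the
operating point `V_q0 = 0` are as in the paper, and in particular `tr M = 0`. -/
theorem gfm_dc_admittance_entries
    (Vd0 Id0 Iq0 : ℝ) (hV : Vd0 ≠ 0)
    (Y : Matrix (Fin 2) (Fin 2) ℂ) :
    let u : Fin 2 → ℂ := ![0, (Vd0 : ℂ)]
    let w : Fin 2 → ℂ := ![-(Iq0 : ℂ), (Id0 : ℂ)]
    let V₀ : Fin 2 → ℂ := ![(Vd0 : ℂ), 0]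
    let I₀ : Fin 2 → ℂ := ![(Id0 : ℂ), (Iq0 : ℂ)]
    let g : Fin 2 → ℂ := Matrix.vecMul V₀ Y + I₀
    ∀ _hg : g ⬝ᵥ u ≠ 0,
    let M : Matrix (Fin 2) (Fin 2) ℂ :=
      Y - (g ⬝ᵥ u)⁻¹ • Matrix.vecMulVec (Y.mulVec u - w) g
    M 0 0 = -(Id0 : ℂ) / (Vd0 : ℂ) ∧
    M 0 1 = -(Iq0 : ℂ) / (Vd0 : ℂ) ∧
    M 1 1 = (Id0 : ℂ) / (Vd0 : ℂ) ∧
    M.trace = 0 := by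
  intro u w V₀ I₀ g hg M
  have hVc : (Vd0 : ℂ) ≠ 0 := by exact_mod_cast hV
  have hg0 : g 0 = Vd0 * Y 0 0 + Id0 := by
    simp [g, V₀, I₀, Matrix.vecHead, Matrix.vecTail, Matrix.vecMul_eq_sum]
  have hg1 : g 1 = Vd0 * Y 0 1 + Iq0 := by
    simp [g, V₀, I₀, Matrix.vecHead, Matrix.vecTail, Matrix.vecMul_eq_sum]
  have hgu : g ⬝ᵥ u = g 1 * Vd0 := by
    simp [u, dotProduct, Fin.sum_univ_two]
  have hne : g 1 ≠ 0 := left_ne_zero_of_mul (hgu ▸ hg)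
  have hr0 : (Y.mulVec u - w) 0 = g 1 := by
    rw [hg1]
    simp [u, w, mul_comm]
  have hr1 : (Y.mulVec u - w) 1 = Vd0 * Y 1 1 - Id0 := by
    simp [u, w, mul_comm]
  have hM (i j : Fin 2) :
      M i j = Y i j - (g 1 * Vd0)⁻¹ * ((Y.mulVec u - w) i * g j) := by
    rw [← hgu]
    rfl
  have h00 : M 0 0 = -(Id0 : ℂ) / Vd0 := by
    rw [hM, hr0, hg0]
    field_simp
    ring
  have h01 : M 0 1 = -(Iq0 : ℂ) / Vd0 := by
    rw [hM, hr0]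
    field_simp
    rw [hg1]
    ring
  have h11 : M 1 1 = (Id0 : ℂ) / Vd0 := by
    rw [hM, hr1]
    field_simp
    ring
  refine ⟨h00, h01, h11, ?_⟩
  rw [Matrix.trace_fin_two, h00, h11]
  ring
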